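/- Let f : ℝ × ℝ^N → ℝ^N be Lipschitz Carathéodory with L¹_loc-equicontinuous m-bounds, and let Θ = {θ_j^I} be the suitable set of moduli of continuity defined by θ_j^I(s) := sup_{t ∈ ℝ} ∫_t^{t+s} m^j(u) du, where m^j(t) = sup_{|x|≤j} |f(t,x)| is the optimal m-bound of f on B_j. Let g be Lipschitz Carathéodory such that the translates f_{t_n} converge to g in the σ_Θ sense for some sequence t_n → −∞. Assume that for every s ≤ 0 and every x₀ ∈ ℝ^N the solution x(·, f_s, x₀) of ẋ = f_s(t,x), x(0) = x₀ is defined on [0,∞), and that for every r ∈ ℝ and x₀ ∈ ℝ^N the solution x(·, g_r, x₀) is defined on [0,∞). Suppose there exist τ ∈ ℝ and c > 0 such that for every d > 0 there is T(d) > 0 with |x(s, f_{t−s}, x₀)| ≤ c whenever t ≤ τ, s ≥ T(d) and |x₀| ≤ d. Then the solutions of ẋ = g(t,x) are uniformly ultimately bounded: for every d > 0 there is T'(d) > 0 such that |x(t, g_r, x₀)| ≤ c for every r ∈ ℝ, every t ≥ T'(d), and every x₀ with |x₀| ≤ d. -/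

import Mathlib

open MeasureTheory Set Filter Topology
open scoped RealInnerProductSpace

noncomputable section

abbrev Euc (n : ℕ) := EuclideanSpace ℝ (Fin n)

/-- A function `ℝ → ℝ` is locally integrable (w.r.t. Lebesgue measure) on every
compact interval. -/
def LocInt (m : ℝ → ℝ) : Prop := ∀ a b : ℝ, IntegrableOn m (Icc a b)

section Defs

variable {N : ℕ} {F : Type*} [NormedAddCommGroup F] [NormedSpace ℝ F]

/-- The Carathéodory conditions (C1) and (C2). -/
def IsCara (f : ℝ → Euc N → F) : Prop :=
  StronglyMeasurable (Function.uncurry f) ∧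
  ∀ K : Set (Euc N), IsCompact K → ∃ m : ℝ → ℝ, (∀ t, 0 ≤ m t) ∧ LocInt m ∧
    ∀ᵐ t : ℝ, ∀ x ∈ K, ‖f t x‖ ≤ m t

/-- A suitable set of moduli of continuity `Θ = {θ_j^{[q₁,q₂]}}`. -/
structure SuitableModuli where
  θ : ℕ → ℚ → ℚ → ℝ → ℝ
  nonneg : ∀ j q₁ q₂ s, (0:ℝ) ≤ s → 0 ≤ θ j q₁ q₂ s
  cont : ∀ j q₁ q₂, ContinuousOn (θ j q₁ q₂) (Ici 0)
  mono : ∀ j q₁ q₂, MonotoneOn (θ j q₁ q₂) (Ici 0)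
  zero : ∀ j q₁ q₂, θ j q₁ q₂ 0 = 0
  ordered : ∀ j₁ j₂ q₁ q₂ p₁ p₂, j₁ ≤ j₂ → p₁ ≤ q₁ → q₂ ≤ p₂ →
    ∀ s : ℝ, 0 ≤ s → θ j₁ q₁ q₂ s ≤ θ j₂ p₁ p₂ s

/-- `x ∈ K_j^{[q₁,q₂]}`: continuous, bounded by `j` and with modulus of continuity
`θ_j^{[q₁,q₂]}` on `[q₁,q₂]`. -/
def inK {N : ℕ} (Θ : SuitableModuli) (j : ℕ) (q₁ q₂ : ℚ) (x : ℝ → Euc N) : Prop :=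
  ContinuousOn x (Icc (q₁:ℝ) (q₂:ℝ)) ∧
  (∀ t ∈ Icc (q₁:ℝ) (q₂:ℝ), ‖x t‖ ≤ (j:ℝ)) ∧
  ∀ t ∈ Icc (q₁:ℝ) (q₂:ℝ), ∀ s ∈ Icc (q₁:ℝ) (q₂:ℝ), ‖x t - x s‖ ≤ Θ.θ j q₁ q₂ |t - s|

/-- Weak Θ-Carathéodory functions: Carathéodory conditions plus condition (W). -/
def IsWTC (Θ : SuitableModuli) (f : ℝ → Euc N → F) : Prop :=
  IsCara f ∧
  ∀ (j : ℕ) (q₁ q₂ : ℚ) (xs : ℕ → ℝ → Euc N) (x : ℝ → Euc N),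
    (∀ n, inK Θ j q₁ q₂ (xs n)) → inK Θ j q₁ q₂ x →
    TendstoUniformlyOn (fun n t => xs n t) x atTop (Icc (q₁:ℝ) (q₂:ℝ)) →
    Tendsto (fun n => ∫ t in Icc (q₁:ℝ) (q₂:ℝ), f t (xs n t)) atTop
      (𝓝 (∫ t in Icc (q₁:ℝ) (q₂:ℝ), f t (x t)))

/-- Convergence in the `σ_Θ` sense:
`sup_{x ∈ K_j^I} ‖∫_I (f_n(t,x(t)) − f(t,x(t))) dt‖ → 0` for every `j` and `I`. -/
def SigmaTendsto (Θ : SuitableModuli) (fs : ℕ → ℝ → Euc N → F) (f : ℝ → Euc N → F) : Prop :=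
  ∀ (j : ℕ) (q₁ q₂ : ℚ), ∀ ε > (0:ℝ), ∀ᶠ n in atTop, ∀ x : ℝ → Euc N, inK Θ j q₁ q₂ x →
    ‖∫ t in Icc (q₁:ℝ) (q₂:ℝ), (fs n t (x t) - f t (x t))‖ < ε

end Defs

/-- Lipschitz Carathéodory functions. -/
def IsLC {N : ℕ} (f : ℝ → Euc N → Euc N) : Prop :=
  IsCara f ∧
  ∀ K : Set (Euc N), IsCompact K → ∃ l : ℝ → ℝ, LocInt l ∧
    ∀ᵐ t : ℝ, ∀ x ∈ K, ∀ y ∈ K, ‖f t x - f t y‖ ≤ l t * ‖x - y‖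

/-- The optimal m-bound of `f` on the closed ball `B_j`. -/
def mOpt {N : ℕ} (f : ℝ → Euc N → Euc N) (j : ℕ) (t : ℝ) : ℝ :=
  sSup {v : ℝ | ∃ x : Euc N, ‖x‖ ≤ (j:ℝ) ∧ v = ‖f t x‖}

/-- The time translation `f_r(s,x) = f(s+r,x)`. -/
def timeTranslate {N : ℕ} (f : ℝ → Euc N → Euc N) (r : ℝ) : ℝ → Euc N → Euc N :=
  fun s x => f (s + r) x

/-- `x` is a solution of `ẋ = g(t,x)`, `x(0) = x₀`, defined on `[0,∞)`. -/
def IsSolOn {N : ℕ} (g : ℝ → Euc N → Euc N) (x₀ : Euc N) (x : ℝ → Euc N) : Prop :=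
  ContinuousOn x (Ici 0) ∧ ∀ t ∈ Ici (0:ℝ), x t = x₀ + ∫ s in (0:ℝ)..t, g s (x s)

lemma LocInt.intervalIntegrable {m : ℝ → ℝ} (hm : LocInt m) (a b : ℝ) :
    IntervalIntegrable m volume a b :=
  IntegrableOn.intervalIntegrable (hm (min a b) (max a b))

lemma LocInt.comp_add_right {m : ℝ → ℝ} (hm : LocInt m) (r : ℝ) :
    LocInt fun t => m (t + r) := by
  intro a b
  rcases le_or_gt a b with hab | hab
  · rw [← intervalIntegrable_iff_integrableOn_Icc_of_le hab]
    have := (hm.intervalIntegrable (a + r) (b + r)).comp_add_right r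
    simpa using this
  · simp [Icc_eq_empty_of_lt hab]

lemma ae_comp_add_right {p : ℝ → Prop} (h : ∀ᵐ t : ℝ, p t) (r : ℝ) : ∀ᵐ t : ℝ, p (t + r) :=
  (measurePreserving_add_right volume r).quasiMeasurePreserving.ae h

section Caratheodory

variable {N : ℕ} {f g : ℝ → Euc N → Euc N}

lemma IsCara.timeTranslate (hf : IsCara f) (r : ℝ) : IsCara (timeTranslate f r) := by
  refine ⟨hf.1.comp_measurable (g := fun p : ℝ × Euc N => (p.1 + r, p.2)) (by fun_prop), ?_⟩
  intro K hK
  obtain ⟨m, hm0, hm, hb⟩ := hf.2 K hK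
  exact ⟨fun t => m (t + r), fun t => hm0 _, hm.comp_add_right r, ae_comp_add_right hb r⟩

lemma IsLC.timeTranslate (hf : IsLC f) (r : ℝ) : IsLC (timeTranslate f r) := by
  refine ⟨hf.1.timeTranslate r, fun K hK => ?_⟩
  obtain ⟨l, hl, hb⟩ := hf.2 K hK
  exact ⟨fun t => l (t + r), hl.comp_add_right r, ae_comp_add_right hb r⟩

lemma IsCara.integrableOn_comp (hf : IsCara f) {z : ℝ → Euc N} {a b : ℝ}
    (hz : ContinuousOn z (Icc a b)) : IntegrableOn (fun s => f s (z s)) (Icc a b) := by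
  obtain ⟨m, -, hm, hb⟩ := hf.2 _ (isCompact_Icc.image_of_continuousOn hz)
  refine Integrable.mono' (hm a b) ?_ ?_
  · exact (hf.1.measurable.comp_aemeasurable
      (aemeasurable_id.prodMk (hz.aemeasurable measurableSet_Icc))).aestronglyMeasurable
  · filter_upwards [ae_restrict_of_ae hb, ae_restrict_mem measurableSet_Icc] with t ht hmem
    exact ht _ (mem_image_of_mem z hmem)

lemma IsCara.intervalIntegrable_comp (hf : IsCara f) {z : ℝ → Euc N} {a b : ℝ} (hab : a ≤ b)
    (hz : ContinuousOn z (Icc a b)) : IntervalIntegrable (fun s => f s (z s)) volume a b :=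
  (intervalIntegrable_iff_integrableOn_Icc_of_le hab).2 (hf.integrableOn_comp hz)

lemma mOpt_nonneg (f : ℝ → Euc N → Euc N) (j : ℕ) (t : ℝ) : 0 ≤ mOpt f j t := by
  refine Real.sSup_nonneg ?_
  rintro v ⟨x, -, rfl⟩
  exact norm_nonneg _

lemma IsCara.ae_norm_le_mOpt (hf : IsCara f) (j : ℕ) :
    ∀ᵐ t : ℝ, ∀ x : Euc N, ‖x‖ ≤ j → ‖f t x‖ ≤ mOpt f j t := by
  obtain ⟨m, -, -, hb⟩ := hf.2 _ (isCompact_closedBall (0 : Euc N) j)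
  filter_upwards [hb] with t ht x hx
  refine le_csSup ⟨m t, ?_⟩ ⟨x, hx, rfl⟩
  rintro v ⟨y, hy, rfl⟩
  exact ht y (by simpa using hy)

lemma IsLC.locInt_mOpt (hf : IsLC f) (j : ℕ) : LocInt (mOpt f j) := by
  obtain ⟨m, hm0, hm, hb⟩ := hf.1.2 _ (isCompact_closedBall (0 : Euc N) j)
  obtain ⟨l, -, hlip⟩ := hf.2 _ (isCompact_closedBall (0 : Euc N) j)
  have : Nonempty (Metric.closedBall (0 : Euc N) (j : ℝ)) := ⟨⟨0, by simp⟩⟩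
  set d := TopologicalSpace.denseSeq (Metric.closedBall (0 : Euc N) (j : ℝ)) with hd
  have hmeas : Measurable fun t => ⨆ n, ‖f t (d n)‖ := by
    refine Measurable.iSup fun n => ?_
    exact (hf.1.1.measurable.comp (measurable_id.prodMk measurable_const)).norm
  have heq : mOpt f j =ᵐ[volume] fun t => ⨆ n, ‖f t (d n)‖ := by
    filter_upwards [hb, hlip] with t ht hl
    have hbdd : BddAbove (range fun n => ‖f t (d n)‖) := by
      refine ⟨m t, ?_⟩
      rintro _ ⟨n, rfl⟩
      exact ht _ (d n).2
    have hcont : Continuous fun y : Metric.closedBall (0 : Euc N) (j : ℝ) => f t y := by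
      refine (LipschitzWith.of_dist_le_mul (K := (l t).toNNReal) fun x y => ?_).continuous
      rw [dist_eq_norm, Subtype.dist_eq, dist_eq_norm]
      exact (hl x x.2 y y.2).trans (by gcongr; exact Real.le_coe_toNNReal _)
    apply le_antisymm
    · refine csSup_le ⟨_, 0, by simp, rfl⟩ ?_
      rintro v ⟨x, hx, rfl⟩
      have key : ∀ y : Metric.closedBall (0 : Euc N) (j : ℝ), ‖f t y‖ ≤ ⨆ n, ‖f t (d n)‖ := by
        intro y
        refine (TopologicalSpace.denseRange_denseSeq _).induction_on
          (p := fun y : Metric.closedBall (0 : Euc N) (j : ℝ) => ‖f t y‖ ≤ ⨆ n, ‖f t (d n)‖) y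
          (isClosed_le hcont.norm continuous_const) fun n => le_ciSup hbdd n
      exact key ⟨x, by simpa using hx⟩
    · refine ciSup_le fun n => le_csSup ⟨m t, ?_⟩ ⟨d n, mem_closedBall_zero_iff.1 (d n).2, rfl⟩
      rintro v ⟨y, hy, rfl⟩
      exact ht y (by simpa using hy)
  intro a b
  refine Integrable.mono' (hm a b) ?_ ?_
  · exact (hmeas.aestronglyMeasurable.congr heq.symm).restrict
  · filter_upwards [ae_restrict_of_ae hb] with t ht
    rw [Real.norm_of_nonneg (mOpt_nonneg f j t)]
    refine csSup_le ⟨_, 0, by simp, rfl⟩ ?_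
    rintro v ⟨x, hx, rfl⟩
    exact ht x (by simpa using hx)

lemma IsLC.norm_integral_comp_le (hf : IsLC f) {j : ℕ} {z : ℝ → Euc N} {a b : ℝ} (hab : a ≤ b)
    (hz : ∀ s ∈ Icc a b, ‖z s‖ ≤ j) :
    ‖∫ s in a..b, f s (z s)‖ ≤ ∫ s in a..b, mOpt f j s := by
  refine intervalIntegral.norm_integral_le_of_norm_le hab ?_
    ((hf.locInt_mOpt j).intervalIntegrable a b)
  filter_upwards [hf.1.ae_norm_le_mOpt j] with t ht hmem
  exact ht _ (hz t (Ioc_subset_Icc_self hmem))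

/-- The uniform `L¹_loc`-equicontinuity of the `m`-bounds makes the integrals over intervals of
a given length bounded uniformly in the position of the interval. -/
lemma bddAbove_integral_mOpt (hf : IsLC f) {j : ℕ}
    (hequi : ∃ δ > (0:ℝ), ∀ τ' s s' : ℝ,
      -1 ≤ s → s ≤ s' → s' ≤ 1 → s' - s < δ → ∫ u in Icc s s', mOpt f j (u + τ') < 1) (s : ℝ) :
    BddAbove {v : ℝ | ∃ t : ℝ, v = ∫ u in Icc t (t + s), mOpt f j u} := by
  obtain ⟨δ, hδ, h⟩ := hequi
  have hii := (hf.locInt_mOpt j).intervalIntegrable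
  set η := min (δ / 2) 1 with hη
  have hη0 : 0 < η := lt_min (by positivity) one_pos
  have step : ∀ t, ∫ u in t..t + η, mOpt f j u ≤ 1 := by
    intro t
    have h1 := h t 0 η (by norm_num) hη0.le (min_le_right _ _)
      (by have := min_le_left (δ / 2) 1; linarith)
    rw [integral_Icc_eq_integral_Ioc, ← intervalIntegral.integral_of_le hη0.le,
      intervalIntegral.integral_comp_add_right (fun u => mOpt f j u)] at h1
    rw [zero_add, add_comm η t] at h1
    exact h1.le
  have steps : ∀ (n : ℕ) (t : ℝ), ∫ u in t..t + n * η, mOpt f j u ≤ n := by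
    intro n
    induction n with
    | zero => intro t; simp
    | succ k ih =>
      intro t
      rw [← intervalIntegral.integral_add_adjacent_intervals (hii t (t + k * η)) (hii _ _)]
      have := step (t + k * η)
      have e : t + ((k + 1 : ℕ) : ℝ) * η = t + k * η + η := by push_cast; ring
      rw [e]
      push_cast
      linarith [ih t]
  obtain ⟨n, hn⟩ := exists_nat_gt (s / η)
  refine ⟨n, ?_⟩
  rintro v ⟨t, rfl⟩
  have hs : t + s ≤ t + n * η := by
    rw [div_lt_iff₀ hη0] at hn; linarith
  refine le_trans ?_ (steps n t)
  rw [intervalIntegral.integral_of_le (le_add_of_nonneg_right (by positivity)), ← integral_Icc_eq_integral_Ioc]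
  exact setIntegral_mono_set (hf.locInt_mOpt j _ _)
    (ae_of_all _ fun u => mOpt_nonneg f j u) (Icc_subset_Icc_right hs).eventuallyLE

end Caratheodory
/-- Grönwall's inequality with a locally integrable kernel. -/
lemma exists_gronwall_const {l : ℝ → ℝ} (hl : LocInt l) (hl0 : ∀ t, 0 ≤ l t) (a b : ℝ) :
    ∃ C > (0:ℝ), ∀ u ∈ Icc a b, ∀ w : ℝ → ℝ, ContinuousOn w (Icc a u) →
      (∀ v ∈ Icc a u, 0 ≤ w v) → ∀ ε ≥ (0:ℝ),
      (∀ v ∈ Icc a u, w v ≤ ε + ∫ s in a..v, l s * w s) → ∀ v ∈ Icc a u, w v ≤ C * ε := by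
  have hii := hl.intervalIntegrable
  have hcont : Continuous fun u => ∫ s in a..u, l s :=
    intervalIntegral.continuous_primitive hii a
  obtain ⟨δ, hδ, hunif⟩ := Metric.uniformContinuousOn_iff.1
    (isCompact_Icc.uniformContinuousOn_of_continuous (hcont.continuousOn (s := Icc a b)))
    (1 / 2) (by norm_num)
  set L := |∫ s in a..b, l s| with hL
  have hL0 : 0 ≤ L := abs_nonneg _
  have claim : ∀ k : ℕ, ∃ C > (0:ℝ), ∀ u ∈ Icc a b, u ≤ a + k * (δ / 2) → ∀ w : ℝ → ℝ,
      ContinuousOn w (Icc a u) → (∀ v ∈ Icc a u, 0 ≤ w v) → ∀ ε ≥ (0:ℝ),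
      (∀ v ∈ Icc a u, w v ≤ ε + ∫ s in a..v, l s * w s) → ∀ v ∈ Icc a u, w v ≤ C * ε := by
    intro k
    induction k with
    | zero =>
      refine ⟨1, one_pos, fun u hu hu' w _ _ ε _ hw v hv => ?_⟩
      have hva : v = a := le_antisymm (hv.2.trans (by simpa using hu')) hv.1
      have := hw v hv
      rw [hva, intervalIntegral.integral_same] at this
      rw [hva]; linarith
    | succ k ih =>
      obtain ⟨C, hC, ih⟩ := ih
      refine ⟨2 * (1 + L * C) + C, by positivity, fun u hu hu' w hwc hw0 ε hε hw => ?_⟩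
      set p := min u (a + k * (δ / 2)) with hp
      have hap : a ≤ p := le_min hu.1 (le_add_of_nonneg_right (by positivity))
      have hpu : p ≤ u := min_le_left _ _
      have ihp := ih p ⟨hap, hpu.trans hu.2⟩ (min_le_right _ _) w
        (hwc.mono (Icc_subset_Icc_right hpu))
        (fun v hv => hw0 v ⟨hv.1, hv.2.trans hpu⟩) ε hε
        (fun v hv => hw v ⟨hv.1, hv.2.trans hpu⟩)
      obtain ⟨q, hq, hmax⟩ := isCompact_Icc.exists_isMaxOn (nonempty_Icc.2 hu.1) hwc
      suffices hM : w q ≤ (2 * (1 + L * C) + C) * ε from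
        fun v hv => (isMaxOn_iff.1 hmax v hv).trans hM
      have hLC : 0 ≤ L * C * ε := by positivity
      have hCε : 0 ≤ C * ε := by positivity
      rcases le_or_gt q p with hqp | hpq
      · have := ihp q ⟨hq.1, hqp⟩
        nlinarith
      · have hlw : ∀ x y, a ≤ x → x ≤ y → y ≤ u →
            IntervalIntegrable (fun s => l s * w s) volume x y := fun x y hx hxy hy =>
          (hii x y).mul_continuousOn
            (hwc.mono (by rw [uIcc_of_le hxy]; exact Icc_subset_Icc hx hy))
        have h1 : ∫ s in a..p, l s * w s ≤ L * (C * ε) := by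
          have : ∫ s in a..p, l s * w s ≤ ∫ s in a..p, l s * (C * ε) :=
            intervalIntegral.integral_mono_on hap (hlw a p le_rfl hap hpu)
              ((hii a p).mul_const _)
              fun s hs => mul_le_mul_of_nonneg_left (ihp s hs) (hl0 s)
          rw [intervalIntegral.integral_mul_const] at this
          refine this.trans (mul_le_mul_of_nonneg_right ?_ hCε)
          refine le_trans ?_ (le_abs_self _)
          exact intervalIntegral.integral_mono_interval le_rfl hap (hpu.trans hu.2)
            (ae_of_all _ hl0) (hii a b)
        have h2 : ∫ s in p..q, l s * w s ≤ 1 / 2 * w q := by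
          have : ∫ s in p..q, l s * w s ≤ ∫ s in p..q, l s * w q :=
            intervalIntegral.integral_mono_on hpq.le (hlw p q hap hpq.le hq.2)
              ((hii p q).mul_const _) fun s hs =>
                mul_le_mul_of_nonneg_left
                  (isMaxOn_iff.1 hmax s ⟨hap.trans hs.1, hs.2.trans hq.2⟩) (hl0 s)
          rw [intervalIntegral.integral_mul_const] at this
          refine this.trans (mul_le_mul_of_nonneg_right ?_ (hw0 q hq))
          have hpk : p = a + k * (δ / 2) := by
            rcases min_choice u (a + k * (δ / 2)) with h | h
            · exact absurd (hpq.trans_le hq.2) (by rw [hp, h]; exact lt_irrefl _)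
            · exact h
          have hd : dist q p < δ := by
            rw [Real.dist_eq, abs_of_pos (sub_pos.2 hpq), hpk]
            push_cast at hu'
            linarith [hq.2]
          have := hunif q ⟨hq.1, hq.2.trans hu.2⟩ p ⟨hap, hpu.trans hu.2⟩ hd
          rw [Real.dist_eq, intervalIntegral.integral_interval_sub_left (hii _ _) (hii _ _)] at this
          exact (le_abs_self _).trans this.le
        have h3 := hw q hq
        rw [← intervalIntegral.integral_add_adjacent_intervals (hlw a p le_rfl hap hpu)
          (hlw p q hap hpq.le hq.2)] at h3
        nlinarith
  obtain ⟨k, hk⟩ := exists_nat_gt ((b - a) / (δ / 2))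
  obtain ⟨C, hC, h⟩ := claim k
  refine ⟨C, hC, fun u hu => h u hu ?_⟩
  rw [div_lt_iff₀ (by positivity)] at hk
  linarith [hu.2]

/-- `y` solves `ẏ = h(t,y)`, `y(a) = x₀`, on `[a,b]`. -/
def IsSolIcc {N : ℕ} (h : ℝ → Euc N → Euc N) (a b : ℝ) (x₀ : Euc N) (y : ℝ → Euc N) : Prop :=
  ContinuousOn y (Icc a b) ∧ ∀ t ∈ Icc a b, y t = x₀ + ∫ s in a..t, h s (y s)

section Solutions

variable {N : ℕ} {f g : ℝ → Euc N → Euc N} {Θ : SuitableModuli}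

lemma IsSolIcc.mono {h : ℝ → Euc N → Euc N} {a b u : ℝ} {x₀ : Euc N} {y : ℝ → Euc N}
    (hy : IsSolIcc h a b x₀ y) (hu : u ≤ b) : IsSolIcc h a u x₀ y :=
  ⟨hy.1.mono (Icc_subset_Icc_right hu), fun t ht => hy.2 t ⟨ht.1, ht.2.trans hu⟩⟩

lemma IsSolIcc.sub_eq_integral {h : ℝ → Euc N → Euc N} (hh : IsCara h) {a b s t : ℝ}
    {x₀ : Euc N} {y : ℝ → Euc N} (hy : IsSolIcc h a b x₀ y) (hs : s ∈ Icc a b)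
    (ht : t ∈ Icc a b) : y t - y s = ∫ v in s..t, h v (y v) := by
  have hint : ∀ u ∈ Icc a b, IntervalIntegrable (fun v => h v (y v)) volume a u := fun u hu =>
    hh.intervalIntegrable_comp hu.1 (hy.1.mono (Icc_subset_Icc_right hu.2))
  rw [hy.2 t ht, hy.2 s hs, add_sub_add_left_eq_sub,
    intervalIntegral.integral_interval_sub_left (hint t ht) (hint s hs)]

lemma IsSolOn.isSolIcc {h : ℝ → Euc N → Euc N} {r t : ℝ} {x₀ : Euc N} {x : ℝ → Euc N}
    (hx : IsSolOn (timeTranslate h r) x₀ x) : IsSolIcc h r (r + t) x₀ fun u => x (u - r) := by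
  refine ⟨hx.1.comp (by fun_prop) fun u hu => sub_nonneg.2 hu.1, fun u hu => ?_⟩
  have h1 := hx.2 (u - r) (sub_nonneg.2 hu.1)
  have h2 := intervalIntegral.integral_comp_sub_right
    (fun s => timeTranslate h r s (x s)) (a := r) (b := u) r
  rw [sub_self] at h2
  simp only [timeTranslate, sub_add_cancel] at h1 h2
  change x (u - r) = x₀ + ∫ s in r..u, h s (x (s - r))
  rw [h1, ← h2]

lemma IsSolIcc.inK_projIcc (hf : IsLC f)
    (hmod : ∀ (j : ℕ) (q₁ q₂ : ℚ) (t s : ℝ), t ≤ s →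
      ∫ u in t..s, mOpt f j u ≤ Θ.θ j q₁ q₂ (s - t))
    {r a b : ℝ} (hab : a ≤ b) {x₀ : Euc N} {y : ℝ → Euc N}
    (hy : IsSolIcc (timeTranslate f r) a b x₀ y) {j : ℕ} (hj : ∀ s ∈ Icc a b, ‖y s‖ ≤ j)
    (q₁ q₂ : ℚ) : inK Θ j q₁ q₂ fun v => y (projIcc a b hab v) := by
  have key : ∀ s ∈ Icc a b, ∀ t ∈ Icc a b, s ≤ t → ‖y t - y s‖ ≤ Θ.θ j q₁ q₂ (t - s) := by
    intro s hs t ht hst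
    rw [hy.sub_eq_integral (hf.timeTranslate r).1 hs ht]
    refine ((hf.timeTranslate r).norm_integral_comp_le hst fun v hv =>
      hj v ⟨hs.1.trans hv.1, hv.2.trans ht.2⟩).trans ?_
    have h1 := intervalIntegral.integral_comp_add_right (mOpt f j) (a := s) (b := t) r
    have h2 := hmod j q₁ q₂ (s + r) (t + r) (by linarith)
    rw [add_sub_add_right_eq_sub] at h2
    exact h1.trans_le h2
  have key' : ∀ s ∈ Icc a b, ∀ t ∈ Icc a b, ‖y t - y s‖ ≤ Θ.θ j q₁ q₂ |t - s| := by
    intro s hs t ht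
    rcases le_total s t with h | h
    · rw [abs_of_nonneg (sub_nonneg.2 h)]; exact key s hs t ht h
    · rw [abs_of_nonpos (sub_nonpos.2 h), neg_sub, norm_sub_rev]; exact key t ht s hs h
  refine ⟨?_, fun t _ => hj _ (projIcc a b hab t).2, fun t _ s _ => ?_⟩
  · exact (hy.1.comp_continuous (continuous_subtype_val.comp continuous_projIcc)
      fun v => (projIcc a b hab v).2).continuousOn
  · refine (key' _ (projIcc a b hab s).2 _ (projIcc a b hab t).2).trans ?_
    exact Θ.mono j q₁ q₂ (mem_Ici.2 (abs_nonneg _)) (mem_Ici.2 (abs_nonneg _)) (abs_projIcc_sub_projIcc hab)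

/-- `σ_Θ` convergence controls integrals over all subintervals of a compact interval uniformly. -/
lemma SigmaTendsto.eventually_norm_integral_le (hf : IsLC f) (hg : IsLC g)
    (hmod : ∀ (j : ℕ) (q₁ q₂ : ℚ) (t s : ℝ), t ≤ s →
      ∫ u in t..s, mOpt f j u ≤ Θ.θ j q₁ q₂ (s - t))
    {ts : ℕ → ℝ} (hconv : SigmaTendsto Θ (fun n => timeTranslate f (ts n)) g)
    (a b : ℝ) (j : ℕ) {ε : ℝ} (hε : 0 < ε) :
    ∀ᶠ n in atTop, ∀ z : ℝ → Euc N, Continuous z → (∀ s, ‖z s‖ ≤ j) →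
      (∀ q₁ q₂, inK Θ j q₁ q₂ z) → ∀ u ∈ Icc a b,
      ‖∫ s in a..u, (timeTranslate f (ts n) s (z s) - g s (z s))‖ ≤ ε := by
  have hgi := (hg.locInt_mOpt j).intervalIntegrable
  obtain ⟨δ₁, hδ₁, hunif⟩ := Metric.uniformContinuousOn_iff.1
    (isCompact_Icc.uniformContinuousOn_of_continuous
      ((intervalIntegral.continuous_primitive hgi a).continuousOn (s := Icc (a - 1) b)))
    (ε / 6) (by positivity)
  obtain ⟨δ₂, hδ₂, hθ⟩ := Metric.continuousWithinAt_iff.1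
    (Θ.cont j 0 0 0 self_mem_Ici) (ε / 6) (by positivity)
  obtain ⟨δ, hδ0, hδ⟩ := exists_rat_btwn (lt_min one_pos (lt_min hδ₁ hδ₂))
  obtain ⟨hδ1, hδ'⟩ := lt_min_iff.1 hδ
  obtain ⟨hδδ₁, hδδ₂⟩ := lt_min_iff.1 hδ'
  have hint : ∀ n (z : ℝ → Euc N), Continuous z → ∀ s t : ℝ,
      IntervalIntegrable (fun s => timeTranslate f (ts n) s (z s) - g s (z s)) volume s t := by
    intro n z hz s t
    have : ∀ h : ℝ → Euc N → Euc N, IsCara h →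
        IntervalIntegrable (fun v => h v (z v)) volume s t := fun h hh =>
      IntegrableOn.intervalIntegrable (hh.integrableOn_comp hz.continuousOn)
    exact (this _ (hf.timeTranslate _).1).sub (this _ hg.1)
  have short : ∀ n (z : ℝ → Euc N), Continuous z → (∀ s, ‖z s‖ ≤ j) → ∀ s t : ℝ,
      a - 1 ≤ s → s ≤ t → t ≤ b → t - s ≤ δ →
      ‖∫ v in s..t, (timeTranslate f (ts n) v (z v) - g v (z v))‖ ≤ ε / 3 := by
    intro n z hz hzj s t has hst htb hts
    have h1 : ‖∫ v in s..t, timeTranslate f (ts n) v (z v)‖ ≤ ε / 6 := by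
      refine ((hf.timeTranslate _).norm_integral_comp_le hst fun v _ => hzj v).trans ?_
      have e := intervalIntegral.integral_comp_add_right (mOpt f j) (a := s) (b := t) (ts n)
      have h2 := hmod j 0 0 (s + ts n) (t + ts n) (by linarith)
      rw [add_sub_add_right_eq_sub] at h2
      refine (e.trans_le h2).trans ?_
      have h3 := hθ (x := t - s) (sub_nonneg.2 hst)
        (by rw [Real.dist_eq, sub_zero, abs_of_nonneg (sub_nonneg.2 hst)]; linarith)
      rw [Θ.zero, Real.dist_eq, sub_zero] at h3
      exact (le_abs_self _).trans h3.le
    have h2 : ‖∫ v in s..t, g v (z v)‖ ≤ ε / 6 := by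
      refine (hg.norm_integral_comp_le hst fun v _ => hzj v).trans ?_
      have h3 := hunif t ⟨has.trans hst, htb⟩ s ⟨has, hst.trans htb⟩
        (by rw [Real.dist_eq, abs_of_nonneg (sub_nonneg.2 hst)]; linarith)
      rw [Real.dist_eq, intervalIntegral.integral_interval_sub_left (hgi _ _) (hgi _ _)] at h3
      exact (le_abs_self _).trans h3.le
    rw [intervalIntegral.integral_sub
      ((hf.timeTranslate _).1.intervalIntegrable_comp hst hz.continuousOn)
      (hg.1.intervalIntegrable_comp hst hz.continuousOn)]
    linarith [norm_sub_le (∫ v in s..t, timeTranslate f (ts n) v (z v)) (∫ v in s..t, g v (z v))]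
  obtain ⟨p, hp1, hp2⟩ := exists_rat_btwn (show a - δ < a by linarith)
  have hgrid : ∀ᶠ n in atTop, ∀ k ∈ Finset.range (⌊(b - p) / δ⌋₊ + 1), ∀ z : ℝ → Euc N,
      inK Θ j p (p + k * δ) z →
      ‖∫ t in Icc (p:ℝ) ((p + k * δ : ℚ):ℝ), (timeTranslate f (ts n) t (z t) - g t (z t))‖
        < ε / 3 :=
    (Filter.eventually_all_finset _).2 fun k _ => hconv j p (p + k * δ) _ (by positivity)
  filter_upwards [hgrid] with n hn z hz hzj hzK u hu
  set k := ⌊(u - p) / δ⌋₊ with hk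
  have hup : 0 ≤ (u - p) / δ := div_nonneg (by linarith [hu.1]) hδ0.le
  have hku : p + k * δ ≤ u := by
    have := Nat.floor_le hup
    rw [← hk, le_div_iff₀ hδ0] at this
    linarith
  have huk : u - (p + k * δ) ≤ δ := by
    have := Nat.lt_floor_add_one ((u - p) / δ)
    rw [← hk, div_lt_iff₀ hδ0] at this
    linarith
  have hpk : (p:ℝ) ≤ p + k * δ := le_add_of_nonneg_right (by positivity)
  have hkm : k ∈ Finset.range (⌊(b - p) / δ⌋₊ + 1) := by
    rw [Finset.mem_range, Nat.lt_succ_iff]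
    refine Nat.floor_le_floor ?_
    gcongr
    exact hu.2
  have hmid := hn k hkm z (hzK _ _)
  push_cast at hmid
  rw [integral_Icc_eq_integral_Ioc, ← intervalIntegral.integral_of_le hpk] at hmid
  have hfirst := short n z hz hzj p a (by linarith) hp2.le (hu.1.trans hu.2) (by linarith)
  have hlast := short n z hz hzj (p + k * δ) u (by linarith) hku hu.2 huk
  have hi := hint n z hz
  rw [← intervalIntegral.integral_interval_sub_left (hi p u) (hi p a),
    ← intervalIntegral.integral_add_adjacent_intervals (hi p (p + k * δ)) (hi _ u)]
  refine (norm_sub_le _ _).trans ?_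
  linarith [norm_add_le
    (∫ v in (p:ℝ)..(p + k * δ), (timeTranslate f (ts n) v (z v) - g v (z v)))
    (∫ v in (p + k * δ : ℝ)..u, (timeTranslate f (ts n) v (z v) - g v (z v)))]

/-- Solutions depend continuously on the vector field in the `σ_Θ` sense. -/
lemma SigmaTendsto.eventually_norm_sol_sub_le (hf : IsLC f) (hg : IsLC g)
    (hmod : ∀ (j : ℕ) (q₁ q₂ : ℚ) (t s : ℝ), t ≤ s →
      ∫ u in t..s, mOpt f j u ≤ Θ.θ j q₁ q₂ (s - t))
    {ts : ℕ → ℝ} (hconv : SigmaTendsto Θ (fun n => timeTranslate f (ts n)) g)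
    {a b : ℝ} (hab : a ≤ b) {x₀ : Euc N} {Y : ℝ → Euc N} (hY : IsSolIcc g a b x₀ Y)
    {η : ℝ} (hη : 0 < η) :
    ∀ᶠ n in atTop, ∀ y, IsSolIcc (timeTranslate f (ts n)) a b x₀ y → ‖y b - Y b‖ ≤ η := by
  obtain ⟨R, hR⟩ := isCompact_Icc.exists_bound_of_continuousOn hY.1
  obtain ⟨j, hj⟩ := exists_nat_ge (R + 1)
  obtain ⟨l, hl, hlip⟩ := hg.2 _ (isCompact_closedBall (0 : Euc N) j)
  have hl' : LocInt fun t => |l t| := fun s t => (hl s t).abs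
  obtain ⟨C, hC, hgron⟩ := exists_gronwall_const hl' (fun t => abs_nonneg _) a b
  set ε := min (1 / 2) η / C with hε
  have hε0 : 0 < ε := by positivity
  have hCε : C * ε = min (1 / 2) η := by rw [hε]; field_simp
  filter_upwards [hconv.eventually_norm_integral_le hf hg hmod a b j hε0] with n hn y hy
  have hF := (hf.timeTranslate (ts n))
  have claim : ∀ u ∈ Icc a b, (∀ s ∈ Icc a u, ‖y s‖ ≤ j) →
      ∀ v ∈ Icc a u, ‖y v - Y v‖ ≤ C * ε := by
    intro u hu hju
    have hyu := hy.mono hu.2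
    have hYu := hY.mono hu.2
    set z : ℝ → Euc N := fun v => y (projIcc a u hu.1 v) with hz
    have hzc : Continuous z := hyu.1.comp_continuous
      (continuous_subtype_val.comp continuous_projIcc) fun v => (projIcc a u hu.1 v).2
    have hzj : ∀ s, ‖z s‖ ≤ j := fun s => hju _ (projIcc a u hu.1 s).2
    have hzy : ∀ s ∈ Icc a u, z s = y s := fun s hs => by
      rw [hz]; simp only [projIcc_of_mem hu.1 hs]
    have hbd := hn z hzc hzj (hyu.inK_projIcc hf hmod hu.1 hju)
    refine hgron u hu (fun v => ‖y v - Y v‖) (hyu.1.sub hYu.1).norm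
      (fun v _ => norm_nonneg _) ε hε0.le fun v hv => ?_
    have hsub : Icc a v ⊆ Icc a u := Icc_subset_Icc_right hv.2
    have i1 := hF.1.intervalIntegrable_comp hv.1 (hyu.1.mono hsub)
    have i2 := hg.1.intervalIntegrable_comp hv.1 (hyu.1.mono hsub)
    have i3 := hg.1.intervalIntegrable_comp hv.1 (hYu.1.mono hsub)
    have e1 : ∫ s in a..v, (timeTranslate f (ts n) s (z s) - g s (z s))
        = ∫ s in a..v, (timeTranslate f (ts n) s (y s) - g s (y s)) := by
      refine intervalIntegral.integral_congr fun s hs => ?_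
      rw [uIcc_of_le hv.1] at hs
      simp only [hzy s (hsub hs)]
    have e2 : y v - Y v = (∫ s in a..v, (timeTranslate f (ts n) s (y s) - g s (y s)))
        + ∫ s in a..v, (g s (y s) - g s (Y s)) := by
      rw [hyu.2 v hv, hYu.2 v hv, intervalIntegral.integral_sub i1 i2,
        intervalIntegral.integral_sub i2 i3]
      abel
    have h1 := hbd v ⟨hv.1, hv.2.trans hu.2⟩
    rw [e1] at h1
    have h2 : ‖∫ s in a..v, (g s (y s) - g s (Y s))‖ ≤ ∫ s in a..v, |l s| * ‖y s - Y s‖ := by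
      refine intervalIntegral.norm_integral_le_of_norm_le hv.1 ?_
        ((hl'.intervalIntegrable a v).mul_continuousOn ?_)
      · filter_upwards [hlip] with s hs hmem
        have hsu := hsub (Ioc_subset_Icc_self hmem)
        refine (hs _ (mem_closedBall_zero_iff.2 (hju s hsu)) _
          (mem_closedBall_zero_iff.2 ?_)).trans ?_
        · linarith [hR s ⟨hsu.1, hsu.2.trans hu.2⟩]
        · gcongr
          exact le_abs_self _
      · rw [uIcc_of_le hv.1]
        exact ((hyu.1.sub hYu.1).mono hsub).norm
    rw [e2]
    exact (norm_add_le _ _).trans (add_le_add h1 h2)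
  have hball : ∀ s ∈ Icc a b, ‖y s - Y s‖ ≤ 1 → ‖y s‖ ≤ j := by
    intro s hs h
    have := norm_add_le (y s - Y s) (Y s)
    rw [sub_add_cancel] at this
    linarith [hR s hs]
  have hDc : ContinuousOn (fun s => ‖y s - Y s‖) (Icc a b) := (hy.1.sub hY.1).norm
  have hDa : ‖y a - Y a‖ = 0 := by
    rw [hy.2 a (left_mem_Icc.2 hab), hY.2 a (left_mem_Icc.2 hab)]
    simp
  have hD : ∀ s ∈ Icc a b, ‖y s - Y s‖ ≤ 1 := by
    by_contra! hcon
    obtain ⟨s, hs, hs1⟩ := hcon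
    have hZ : IsCompact (Icc a b ∩ (fun s => ‖y s - Y s‖) ⁻¹' Ici 1) :=
      isCompact_Icc.of_isClosed_subset (hDc.preimage_isClosed_of_isClosed isClosed_Icc isClosed_Ici)
        inter_subset_left
    obtain ⟨u, ⟨hu, hu1⟩, hmin⟩ := hZ.exists_isLeast ⟨s, hs, hs1.le⟩
    have hle : ∀ v ∈ Icc a u, ‖y v - Y v‖ ≤ 1 := by
      obtain ⟨u', hu', hu'1⟩ := intermediate_value_Icc hu.1
        (hDc.mono (Icc_subset_Icc_right hu.2)) (show (1:ℝ) ∈ Icc _ _ from ⟨by simp [hDa], hu1⟩)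
      have huu' : u' = u := le_antisymm hu'.2 (hmin ⟨⟨hu'.1, hu'.2.trans hu.2⟩, hu'1.ge⟩)
      intro v hv
      rcases hv.2.eq_or_lt with h | h
      · rw [h, ← huu']; exact hu'1.le
      · by_contra! hv1
        exact absurd (hmin ⟨⟨hv.1, hv.2.trans hu.2⟩, hv1.le⟩) (not_le.2 h)
    have := claim u hu (fun v hv => hball v ⟨hv.1, hv.2.trans hu.2⟩ (hle v hv)) u
      (right_mem_Icc.2 hu.1)
    rw [hCε] at this
    have h2 : (1:ℝ) ≤ ‖y u - Y u‖ := hu1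
    linarith [min_le_left (1 / 2) η]
  have := claim b (right_mem_Icc.2 hab) (fun s hs => hball s hs (hD s hs)) b (right_mem_Icc.2 hab)
  rw [hCε] at this
  exact this.trans (min_le_right _ _)

end Solutions

/-- strong pullback bounded dissipativity of the process induced by
`f` on `(−∞,τ]` implies uniform ultimate boundedness for every `g` in the alpha
limit set of `f` (σ_Θ-limit of translates `f_{t_n}`, `t_n → −∞`). -/
theorem stmt11 {N : ℕ} (f : ℝ → Euc N → Euc N) (hf : IsLC f)
    (hequi : ∀ j : ℕ, ∀ r > (0:ℝ), ∀ ε > (0:ℝ), ∃ δ > (0:ℝ), ∀ τ' s s' : ℝ,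
      -r ≤ s → s ≤ s' → s' ≤ r → s' - s < δ → ∫ u in Icc s s', mOpt f j (u + τ') < ε)
    (Θ : SuitableModuli)
    (hΘ : ∀ (j : ℕ) (q₁ q₂ : ℚ) (s : ℝ), 0 ≤ s →
      Θ.θ j q₁ q₂ s = sSup {v : ℝ | ∃ t : ℝ, v = ∫ u in Icc t (t + s), mOpt f j u})
    (g : ℝ → Euc N → Euc N) (hg : IsLC g)
    (ts : ℕ → ℝ) (hts : Tendsto ts atTop atBot)
    (hconv : SigmaTendsto Θ (fun n => timeTranslate f (ts n)) g)
    (hfsol : ∀ s ≤ (0:ℝ), ∀ x₀ : Euc N, ∃ x : ℝ → Euc N, IsSolOn (timeTranslate f s) x₀ x)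
    (hgsol : ∀ (r : ℝ) (x₀ : Euc N), ∃ x : ℝ → Euc N, IsSolOn (timeTranslate g r) x₀ x)
    (τ c : ℝ) (hc : 0 < c)
    (hdiss : ∀ d > (0:ℝ), ∃ T > (0:ℝ), ∀ t ≤ τ, ∀ s ≥ T, ∀ x₀ : Euc N, ‖x₀‖ ≤ d →
      ∀ x : ℝ → Euc N, IsSolOn (timeTranslate f (t - s)) x₀ x → ‖x s‖ ≤ c) :
    ∀ d > (0:ℝ), ∃ T' > (0:ℝ), ∀ (r : ℝ), ∀ t ≥ T', ∀ x₀ : Euc N, ‖x₀‖ ≤ d →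
      ∀ x : ℝ → Euc N, IsSolOn (timeTranslate g r) x₀ x → ‖x t‖ ≤ c := by
  have hmod : ∀ (j : ℕ) (q₁ q₂ : ℚ) (t s : ℝ), t ≤ s →
      ∫ u in t..s, mOpt f j u ≤ Θ.θ j q₁ q₂ (s - t) := by
    intro j q₁ q₂ t s hts
    rw [hΘ j q₁ q₂ (s - t) (sub_nonneg.2 hts)]
    refine le_csSup (bddAbove_integral_mOpt hf (hequi j 1 one_pos 1 one_pos) _) ⟨t, ?_⟩
    rw [add_sub_cancel, intervalIntegral.integral_of_le hts, integral_Icc_eq_integral_Ioc]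
  intro d hd
  obtain ⟨T, hT, hdT⟩ := hdiss d hd
  refine ⟨T, hT, fun r t ht x₀ hx₀ x hx => le_of_forall_pos_le_add fun η hη => ?_⟩
  have ht0 : 0 ≤ t := hT.le.trans ht
  have hev := hconv.eventually_norm_sol_sub_le hf hg hmod (le_add_of_nonneg_right ht0)
    (hx.isSolIcc (r := r) (t := t)) hη
  obtain ⟨n, hn, hn0, hnτ⟩ := (hev.and ((hts.eventually_le_atBot (-r)).and
    (hts.eventually_le_atBot (τ - r - t)))).exists
  obtain ⟨y, hy⟩ := hfsol (ts n + r) (by linarith) x₀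
  have hyc : ‖y t‖ ≤ c := by
    refine hdT (ts n + r + t) (by linarith) t ht x₀ hx₀ y ?_
    rwa [add_sub_cancel_right]
  have hshift : timeTranslate f (ts n + r) = timeTranslate (timeTranslate f (ts n)) r := by
    funext s v
    simp only [timeTranslate]
    congr 1
    ring
  rw [hshift] at hy
  have := hn _ hy.isSolIcc
  rw [add_sub_cancel_left] at this
  have h2 := norm_sub_norm_le (x t) (y t)
  rw [norm_sub_rev] at h2
  linarith
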